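/- arXiv:1806.08622 — 2 statements merged into one kernel-verified Lean document; each statement's English description precedes it below -/
import Mathlib

section
/- Let I be a combinatorial abelian ideal in Φ⁺, let S ⊆ I be a set of pairwise orthogonal roots, and let γ ∈ Φ⁺ be a positive root. Then there is at most one root a ∈ S such that a + γ ∈ Φ. -/
open scoped RealInnerProductSpace

variable {V : Type*} [NormedAddCommGroup V] [InnerProductSpace ℝ V] [FiniteDimensional ℝ V]

/-- The Cartan integer `⟨a, b∨⟩ = 2⟪a,b⟫/⟪b,b⟫`, i.e. the pairing of `a` with the coroot
of `b`, in a Euclidean realization of the root system. -/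
noncomputable def cartan (a b : V) : ℝ := 2 * ⟪a, b⟫ / ⟪b, b⟫

/-- A finite reduced crystallographic root system `Φ` in a Euclidean space `V`,
together with a base `Δ` (the set `simples`); the corresponding positive system `Φ⁺`
consists of the roots that are nonnegative integer combinations of simple roots. -/
structure RootSystemWithBase (V : Type*) [NormedAddCommGroup V] [InnerProductSpace ℝ V] :
    Type _ where
  roots : Set V
  finite : roots.Finite
  ne_zero : ∀ a ∈ roots, a ≠ (0 : V)
  neg_mem : ∀ a ∈ roots, -a ∈ roots
  reduced : ∀ a ∈ roots, ∀ t : ℝ, t • a ∈ roots → t = 1 ∨ t = -1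
  crystal : ∀ a ∈ roots, ∀ b ∈ roots, ∃ n : ℤ, cartan a b = (n : ℝ)
  reflect_mem : ∀ a ∈ roots, ∀ b ∈ roots, a - cartan a b • b ∈ roots
  simples : Set V
  simples_sub : simples ⊆ roots
  indep : LinearIndependent ℝ (fun a : simples => (a : V))
  decomp : ∀ a ∈ roots,
    (∃ c : V →₀ ℕ, ↑c.support ⊆ simples ∧ a = c.sum fun b n => (n : ℝ) • b) ∨
    (∃ c : V →₀ ℕ, ↑c.support ⊆ simples ∧ -a = c.sum fun b n => (n : ℝ) • b)

namespace RootSystemWithBase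

/-- `v` is a nonnegative integer combination of simple roots. -/
def IsNN (R : RootSystemWithBase V) (v : V) : Prop :=
  ∃ c : V →₀ ℕ, ↑c.support ⊆ R.simples ∧ v = c.sum fun b n => (n : ℝ) • b

/-- The set `Φ⁺` of positive roots. -/
def pos (R : RootSystemWithBase V) : Set V :=
  {a ∈ R.roots | R.IsNN a}

/-- A combinatorial abelian ideal in `Φ⁺`: a subset `I ⊆ Φ⁺` such that (i) if `a ∈ I`,
`b ∈ Φ⁺` and `b - a` is a nonnegative integer combination of simple roots then `b ∈ I`,
and (ii) `a + b ∉ Φ` for all `a, b ∈ I`. -/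
def IsAbelianIdeal (R : RootSystemWithBase V) (I : Set V) : Prop :=
  I ⊆ R.pos ∧
  (∀ a ∈ I, ∀ b ∈ R.pos, R.IsNN (b - a) → b ∈ I) ∧
  (∀ a ∈ I, ∀ b ∈ I, a + b ∉ R.roots)

end RootSystemWithBase

set_option linter.unusedSectionVars false

namespace RootSystemWithBase

/-- Nonnegative integer combinations of simple roots are closed under addition. -/
theorem IsNN.add {R : RootSystemWithBase V} {v w : V} (hv : R.IsNN v) (hw : R.IsNN w) :
    R.IsNN (v + w) := by
  classical
  obtain ⟨c, hc, rfl⟩ := hv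
  obtain ⟨d, hd, rfl⟩ := hw
  refine ⟨c + d, fun x hx => ?_, ?_⟩
  · rcases Finset.mem_union.mp (Finsupp.support_add hx) with h | h
    · exact hc h
    · exact hd h
  · rw [Finsupp.sum_add_index'] <;> simp [add_smul]

/-- There is a linear functional that is positive on all nonzero nonnegative combinations of
simple roots. -/
theorem exists_height (R : RootSystemWithBase V) :
    ∃ f : V →ₗ[ℝ] ℝ, ∀ v, R.IsNN v → v ≠ 0 → 0 < f v := by
  have hind : LinearIndepOn ℝ id R.simples := R.indep
  refine ⟨(Module.Basis.extend hind).constr ℝ fun _ => (1 : ℝ), ?_⟩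
  rintro v ⟨c, hc, rfl⟩ hne
  have hs : ∀ s ∈ R.simples,
      (Module.Basis.extend hind).constr ℝ (fun _ => (1 : ℝ)) s = 1 := fun s hs => by
    have h := (Module.Basis.extend hind).constr_basis ℝ (fun _ => (1 : ℝ))
      ⟨s, hind.subset_extend _ hs⟩
    rwa [Module.Basis.extend_apply_self] at h
  rw [Finsupp.sum, map_sum]
  refine Finset.sum_pos (fun s hs' => ?_) (Finset.nonempty_iff_ne_empty.mpr ?_)
  · rw [map_smul, hs s (hc hs'), smul_eq_mul, mul_one]
    exact_mod_cast Nat.pos_of_ne_zero (Finsupp.mem_support_iff.mp hs')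
  · rintro h
    exact hne (by rw [Finsupp.sum, h, Finset.sum_empty])

/-- The sum of two positive roots is nonzero. -/
theorem add_ne_zero_of_mem_pos (R : RootSystemWithBase V) {a b : V}
    (ha : a ∈ R.pos) (hb : b ∈ R.pos) : a + b ≠ 0 := by
  obtain ⟨f, hf⟩ := R.exists_height
  intro h
  have h₁ := hf a ha.2 (R.ne_zero a ha.1)
  have h₂ := hf b hb.2 (R.ne_zero b hb.1)
  have h₃ : f a + f b = 0 := by rw [← map_add, h, map_zero]
  linarith

/-- The difference of two distinct roots at an acute angle is a root. -/
theorem sub_mem_roots (R : RootSystemWithBase V) {x y : V} (hx : x ∈ R.roots)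
    (hy : y ∈ R.roots) (hxy : 0 < ⟪x, y⟫) (hne : x ≠ y) : x - y ∈ R.roots := by
  have key : ∀ u ∈ R.roots, ∀ v ∈ R.roots, 0 < ⟪u, v⟫ →
      u - v ∈ R.roots ∨ ⟪v, v⟫ ≤ ⟪u, v⟫ := by
    intro u hu v hv huv
    have hvv : 0 < ⟪v, v⟫ := real_inner_self_pos.mpr (R.ne_zero v hv)
    obtain ⟨n, hn⟩ := R.crystal u hu v hv
    have hpos : 0 < cartan u v := by unfold cartan; positivity
    have hn0 : 0 < n := by rw [hn] at hpos; exact_mod_cast hpos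
    rcases eq_or_lt_of_le (show 1 ≤ n from hn0) with rfl | h2
    · left
      simpa [hn] using R.reflect_mem u hu v hv
    · right
      have h2' : (2 : ℝ) ≤ cartan u v := by rw [hn]; exact_mod_cast h2
      rw [cartan, le_div_iff₀ hvv] at h2'
      linarith
  rcases key x hx y hy hxy with h | h₁
  · exact h
  rcases key y hy x hx (by rwa [real_inner_comm]) with h | h₂
  · simpa using R.neg_mem _ h
  have hpos : 0 < ⟪x - y, x - y⟫ := real_inner_self_pos.mpr (sub_ne_zero.mpr hne)
  rw [real_inner_sub_sub_self] at hpos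
  rw [real_inner_comm x y] at h₂
  linarith

/-- Any two elements of a combinatorial abelian ideal have nonnegative inner product. -/
theorem IsAbelianIdeal.inner_nonneg {R : RootSystemWithBase V} {I : Set V}
    (hI : R.IsAbelianIdeal I) {x y : V} (hx : x ∈ I) (hy : y ∈ I) : 0 ≤ ⟪x, y⟫ := by
  by_contra! h
  refine hI.2.2 x hx y hy ?_
  have hne : x ≠ -y := fun he =>
    R.add_ne_zero_of_mem_pos (hI.1 hx) (hI.1 hy) (by rw [he, neg_add_cancel])
  simpa using R.sub_mem_roots (hI.1 hx).1 (R.neg_mem y (hI.1 hy).1)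
    (by rw [inner_neg_right]; linarith) hne

/-- A combinatorial abelian ideal is stable under adding positive roots, within the roots. -/
theorem IsAbelianIdeal.add_mem {R : RootSystemWithBase V} {I : Set V}
    (hI : R.IsAbelianIdeal I) {a γ : V} (ha : a ∈ I) (hγ : γ ∈ R.pos)
    (h : a + γ ∈ R.roots) : a + γ ∈ I :=
  hI.2.1 a ha _ ⟨h, (hI.1 ha).2.add hγ.2⟩ (by rw [add_sub_cancel_left]; exact hγ.2)

end RootSystemWithBase

/-- If `S` is a set of pairwise orthogonal roots in a combinatorial abelian ideal and
`γ ∈ Φ⁺`, then there is at most one root `a ∈ S` with `a + γ ∈ Φ`. -/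
theorem stmt_2 (R : RootSystemWithBase V) (I : Set V) (hI : R.IsAbelianIdeal I)
    (S : Set V) (hSI : S ⊆ I)
    (horth : ∀ a ∈ S, ∀ b ∈ S, a ≠ b → cartan a b = 0)
    (γ : V) (hγ : γ ∈ R.pos) :
    ∀ a ∈ S, ∀ b ∈ S, a + γ ∈ R.roots → b + γ ∈ R.roots → a = b := by
  intro a ha b hb haγ hbγ
  by_contra hab
  have haI := hSI ha
  have hbI := hSI hb
  have hb0 : 0 < ⟪b, b⟫ := real_inner_self_pos.mpr (R.ne_zero b (hI.1 hbI).1)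
  have horth' : ⟪a, b⟫ = 0 := by
    have h := horth a ha b hb hab
    rw [cartan, div_eq_zero_iff] at h
    rcases h with h | h <;> linarith
  have horth'' : ⟪b, a⟫ = 0 := by rw [real_inner_comm, horth']
  have h₁ := hI.inner_nonneg haI (hI.add_mem hbI hγ hbγ)
  have h₂ := hI.inner_nonneg hbI (hI.add_mem haI hγ haγ)
  have hγ0 : 0 < ⟪γ, γ⟫ := real_inner_self_pos.mpr (R.ne_zero γ hγ.1)
  rw [inner_add_right] at h₁ h₂
  have hsub : a - b ∈ R.roots := by
    have h := R.sub_mem_roots haγ hbγ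
      (by
        rw [inner_add_left, inner_add_right, inner_add_right, real_inner_comm b γ]
        linarith)
      (fun h => hab (add_right_cancel h))
    rwa [add_sub_add_right_eq_sub] at h
  refine hI.2.2 a haI b hbI ?_
  have hc : cartan (a - b) b = -2 := by
    rw [cartan, inner_sub_left, horth']
    field_simp
    ring
  have h := R.reflect_mem _ hsub b (hI.1 hbI).1
  rw [hc] at h
  convert h using 1
  module
end

section
/- Let (W, S) be a Coxeter system with Bruhat order ≤, let s ∈ S, and let σ, τ ∈ W be involutions with σ < τ. If s∘σ > σ and s∘τ < τ, then s∘σ ≤ τ and σ ≤ s∘τ. -/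
variable {B W : Type*} [Group W] {M : CoxeterMatrix B}

/-- The Bruhat strict order on a Coxeter group: the partial order generated by the
relations `u < t * u` whenever `t` is a reflection and `ℓ(u) < ℓ(t * u)`. -/
def bruhatLT (cs : CoxeterSystem M W) : W → W → Prop :=
  Relation.TransGen fun u v =>
    (∃ t, cs.IsReflection t ∧ v = t * u) ∧ cs.length u < cs.length v

/-- The Bruhat order on a Coxeter group (the reflexive closure of `bruhatLT`). -/
def bruhatLE (cs : CoxeterSystem M W) : W → W → Prop :=
  Relation.ReflTransGen fun u v =>
    (∃ t, cs.IsReflection t ∧ v = t * u) ∧ cs.length u < cs.length v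

open Classical in
/-- For an involution `σ` and a simple reflection `s = sᵢ`, the involution
`s∘σ`, defined as `sσ` if `sσ = σs` and as `sσs` otherwise. -/
noncomputable def conjOp (cs : CoxeterSystem M W) (i : B) (σ : W) : W :=
  if cs.simple i * σ = σ * cs.simple i then cs.simple i * σ
  else cs.simple i * σ * cs.simple i

namespace CoxeterSystem

variable (cs : CoxeterSystem M W)

open Classical in
/-- The signed conjugation action of the simple reflection `sᵢ` on `W × ZMod 2`: it conjugates the
first coordinate and flips the sign exactly at `sᵢ`. -/
noncomputable def signedConjSimple (i : B) : Equiv.Perm (W × ZMod 2) :=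
  Function.Involutive.toPerm
    (fun p => (cs.simple i * p.1 * cs.simple i, p.2 + if p.1 = cs.simple i then 1 else 0)) <| by
    rintro ⟨t, e⟩
    have h : cs.simple i * t * cs.simple i = cs.simple i ↔ t = cs.simple i := by
      constructor
      · intro h
        simpa [mul_assoc] using congrArg (fun x => cs.simple i * x * cs.simple i) h
      · rintro rfl
        simp
    have h2 : (1 : ZMod 2) + 1 = 0 := by decide
    ext
    · simp [mul_assoc]
    · by_cases ht : t = cs.simple i <;> simp [h, ht, add_assoc, h2]

open Classical in
theorem signedConjSimple_apply (i : B) (t : W) (e : ZMod 2) :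
    cs.signedConjSimple i (t, e) =
      (cs.simple i * t * cs.simple i, e + if t = cs.simple i then 1 else 0) := rfl

open Classical in
theorem signedConjSimple_mul_pow_apply (i j : B) (n : ℕ) (t : W) (e : ZMod 2) :
    ((cs.signedConjSimple i * cs.signedConjSimple j) ^ n) (t, e) =
      ((cs.simple i * cs.simple j) ^ n * t * ((cs.simple i * cs.simple j) ^ n)⁻¹,
        e + ∑ k ∈ Finset.range (2 * n),
          if t = cs.simple j * (cs.simple i * cs.simple j) ^ k then 1 else 0) := by
  induction n with
  | zero => simp
  | succ n ih =>
    set r := cs.simple i * cs.simple j with hr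
    have hinv : r⁻¹ = cs.simple j * cs.simple i := by simp [hr]
    have hsr : ∀ k : ℕ, (r ^ k)⁻¹ * cs.simple j = cs.simple j * r ^ k := by
      intro k
      have h : SemiconjBy (cs.simple j) r r⁻¹ := by
        simp [SemiconjBy, hr, mul_assoc]
      rw [← inv_pow]
      exact ((h.pow_right k).eq).symm
    have h1 : r ^ n * t * (r ^ n)⁻¹ = cs.simple j ↔ t = cs.simple j * r ^ (2 * n) := by
      rw [two_mul, pow_add, ← mul_assoc, ← hsr]
      constructor
      · intro h; rw [← h]; group
      · rintro rfl; group
    have h2 : cs.simple j * (r ^ n * t * (r ^ n)⁻¹) * cs.simple j = cs.simple i ↔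
        t = cs.simple j * r ^ (2 * n + 1) := by
      have h3 : cs.simple j * r ^ (2 * n + 1) =
          (r ^ n)⁻¹ * (cs.simple j * cs.simple i * cs.simple j) * r ^ n := by
        rw [show 2 * n + 1 = n + (1 + n) by ring, pow_add, ← mul_assoc, ← hsr, pow_add, pow_one, hr]
        simp only [mul_assoc]
      rw [h3]
      constructor
      · intro h
        rw [← h]
        simp [mul_assoc]
      · rintro rfl
        simp [mul_assoc]
    rw [pow_succ', Equiv.Perm.mul_apply, ih, Equiv.Perm.mul_apply, signedConjSimple_apply,
      signedConjSimple_apply, show 2 * (n + 1) = 2 * n + 1 + 1 by ring, Finset.sum_range_succ,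
      Finset.sum_range_succ]
    simp only [h1, h2]
    ext
    · simp [pow_succ', hr, mul_assoc]
    · simp only [add_assoc]

theorem isLiftable_signedConjSimple : M.IsLiftable cs.signedConjSimple := by
  classical
  intro i j
  ext1 ⟨t, e⟩
  rw [signedConjSimple_mul_pow_apply, two_mul, Finset.sum_range_add]
  simp only [pow_add, cs.simple_mul_simple_pow, one_mul]
  rw [CharTwo.add_self_eq_zero]
  simp

/-- The signed conjugation action of `W` on `W × ZMod 2`. -/
noncomputable def signedConj : W →* Equiv.Perm (W × ZMod 2) :=
  cs.lift ⟨cs.signedConjSimple, cs.isLiftable_signedConjSimple⟩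

theorem signedConj_simple (i : B) : cs.signedConj (cs.simple i) = cs.signedConjSimple i :=
  cs.lift_apply_simple _ i

open Classical in
theorem signedConj_wordProd_apply (ω : List B) (t : W) (e : ZMod 2) :
    cs.signedConj (cs.wordProd ω) (t, e) =
      (cs.wordProd ω * t * (cs.wordProd ω)⁻¹, e + ((cs.rightInvSeq ω).count t : ZMod 2)) := by
  induction ω with
  | nil => simp
  | cons i ω ih =>
    have h : cs.wordProd ω * t * (cs.wordProd ω)⁻¹ = cs.simple i ↔
        (cs.wordProd ω)⁻¹ * cs.simple i * cs.wordProd ω = t := by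
      constructor
      · intro h; rw [← h]; group
      · rintro rfl; group
    rw [cs.wordProd_cons, map_mul, Equiv.Perm.mul_apply, ih, signedConj_simple,
      signedConjSimple_apply]
    simp only [rightInvSeq, List.count_cons, h, beq_iff_eq]
    simp [mul_assoc, add_assoc]

/-- The parity of the number of occurrences of `t` in the right inversion sequence of any word
for `w`. -/
noncomputable def inversionParity (w t : W) : ZMod 2 := (cs.signedConj w (t, 0)).2

theorem signedConj_apply (w t : W) (e : ZMod 2) :
    cs.signedConj w (t, e) = (w * t * w⁻¹, e + cs.inversionParity w t) := by
  obtain ⟨ω, -, rfl⟩ := cs.exists_isReduced w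
  simp [inversionParity, signedConj_wordProd_apply]

theorem inversionParity_mul (x y t : W) :
    cs.inversionParity (x * y) t =
      cs.inversionParity y t + cs.inversionParity x (y * t * y⁻¹) := by
  rw [inversionParity, map_mul, Equiv.Perm.mul_apply, signedConj_apply, signedConj_apply, zero_add]

open Classical in
theorem inversionParity_simple (i : B) (t : W) :
    cs.inversionParity (cs.simple i) t = if t = cs.simple i then 1 else 0 := by
  simp [inversionParity, signedConj_simple, signedConjSimple_apply]

theorem IsReflection.inversionParity_self {cs : CoxeterSystem M W} {t : W}
    (ht : cs.IsReflection t) : cs.inversionParity t t = 1 := by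
  obtain ⟨w, i, rfl⟩ := ht
  have h1 : cs.inversionParity (w * w⁻¹) (w * cs.simple i * w⁻¹) = 0 := by
    simp [inversionParity]
  rw [inversionParity_mul] at h1
  rw [inversionParity_mul, inversionParity_mul, inversionParity_simple]
  simp only [mul_assoc, inv_mul_cancel_left, inv_inv, inv_mul_cancel, mul_one, one_mul,
    inv_simple, simple_mul_simple_self, if_true] at h1 ⊢
  rw [add_left_comm, h1, add_zero]

theorem length_mul_lt_of_inversionParity_eq_one {w t : W} (h : cs.inversionParity w t = 1) :
    cs.length (w * t) < cs.length w := by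
  classical
  obtain ⟨ω, hω, rfl⟩ := cs.exists_isReduced w
  refine (cs.isRightInversion_of_mem_rightInvSeq hω (List.count_pos_iff.mp ?_)).2
  refine Nat.pos_of_ne_zero fun h0 => ?_
  simp [inversionParity, signedConj_wordProd_apply, h0] at h

theorem IsReflection.inversionParity_eq_one_iff {cs : CoxeterSystem M W} {t : W}
    (ht : cs.IsReflection t) (w : W) :
    cs.inversionParity w t = 1 ↔ cs.length (w * t) < cs.length w := by
  refine ⟨cs.length_mul_lt_of_inversionParity_eq_one, fun hlt => ?_⟩
  by_contra hne
  have h0 : cs.inversionParity w t = 0 := by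
    revert hne
    generalize cs.inversionParity w t = a
    revert a
    decide
  have h1 : cs.inversionParity (w * t) t = 1 := by
    rw [inversionParity_mul, ht.inversionParity_self, mul_inv_cancel_right, h0, add_zero]
  have := cs.length_mul_lt_of_inversionParity_eq_one h1
  rw [mul_assoc, ht.mul_self, mul_one] at this
  omega

theorem IsReflection.length_simple_mul_lt {cs : CoxeterSystem M W} {t : W}
    (ht : cs.IsReflection t) {i : B} (hti : t ≠ cs.simple i) {u : W}
    (h : cs.length u < cs.length (t * u)) :
    cs.length (cs.simple i * u) < cs.length (cs.simple i * (t * u)) := by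
  have ht' : cs.IsReflection (u⁻¹ * t * u) := by simpa using ht.conj u⁻¹
  have hmul : t * u * (u⁻¹ * t * u) = u := by
    rw [mul_assoc u⁻¹, mul_assoc t, mul_inv_cancel_left, ← mul_assoc, ht.mul_self, one_mul]
  have h1 : cs.inversionParity (t * u) (u⁻¹ * t * u) = 1 := by
    rwa [ht'.inversionParity_eq_one_iff, hmul]
  have h2 : cs.inversionParity (cs.simple i * (t * u)) (u⁻¹ * t * u) = 1 := by
    rw [inversionParity_mul, h1, hmul, inversionParity_simple, mul_inv_rev, mul_inv_cancel_left,
      ht.inv, if_neg hti, add_zero]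
  rwa [ht'.inversionParity_eq_one_iff, mul_assoc, hmul] at h2

end CoxeterSystem

section Bruhat

variable {cs : CoxeterSystem M W} {u v : W}

theorem bruhatLT.length_lt (h : bruhatLT cs u v) : cs.length u < cs.length v := by
  induction h with
  | single h => exact h.2
  | tail _ h ih => exact ih.trans h.2

theorem bruhatLE_mul_of_length_lt {t : W} (ht : cs.IsReflection t)
    (h : cs.length u < cs.length (t * u)) : bruhatLE cs u (t * u) :=
  .single ⟨⟨t, ht, rfl⟩, h⟩

theorem bruhatLE.inv (h : bruhatLE cs u v) : bruhatLE cs u⁻¹ v⁻¹ := by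
  refine Relation.ReflTransGen.lift (·⁻¹) ?_ _ _ h
  rintro a b ⟨⟨t, ht, rfl⟩, hlt⟩
  refine ⟨⟨a⁻¹ * t * a, by simpa using ht.conj a⁻¹, ?_⟩, by simpa only [cs.length_inv] using hlt⟩
  simp [ht.inv]

open Classical in
/-- The larger of `w` and `sᵢ w`. -/
noncomputable def leftUp (cs : CoxeterSystem M W) (i : B) (w : W) : W :=
  if cs.length w < cs.length (cs.simple i * w) then cs.simple i * w else w

open Classical in
/-- The smaller of `w` and `sᵢ w`. -/
noncomputable def leftDown (cs : CoxeterSystem M W) (i : B) (w : W) : W :=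
  if cs.length w < cs.length (cs.simple i * w) then w else cs.simple i * w

theorem bruhatLE_simple_mul {i : B} (h : cs.length u < cs.length (cs.simple i * u)) :
    bruhatLE cs u (cs.simple i * u) :=
  bruhatLE_mul_of_length_lt (cs.isReflection_simple i) h

theorem simple_mul_bruhatLE {i : B} (h : ¬ cs.length u < cs.length (cs.simple i * u)) :
    bruhatLE cs (cs.simple i * u) u := by
  have h' := bruhatLE_simple_mul (cs := cs) (u := cs.simple i * u) (i := i)
  rw [cs.simple_mul_simple_cancel_left] at h'
  exact h' ((not_lt.mp h).lt_of_ne (cs.length_simple_mul_ne u i))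

theorem bruhatLE_leftUp (cs : CoxeterSystem M W) (i : B) (w : W) :
    bruhatLE cs w (leftUp cs i w) ∧ bruhatLE cs (cs.simple i * w) (leftUp cs i w) := by
  unfold leftUp
  split_ifs with h
  · exact ⟨bruhatLE_simple_mul h, .refl⟩
  · exact ⟨.refl, simple_mul_bruhatLE h⟩

theorem leftDown_bruhatLE (cs : CoxeterSystem M W) (i : B) (w : W) :
    bruhatLE cs (leftDown cs i w) w ∧ bruhatLE cs (leftDown cs i w) (cs.simple i * w) := by
  unfold leftDown
  split_ifs with h
  · exact ⟨.refl, bruhatLE_simple_mul h⟩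
  · exact ⟨simple_mul_bruhatLE h, .refl⟩

theorem leftUp_eq_or (cs : CoxeterSystem M W) (i : B) (w : W) :
    leftUp cs i w = w ∨ leftUp cs i w = cs.simple i * w := by
  unfold leftUp
  split_ifs <;> simp

theorem leftDown_eq_or (cs : CoxeterSystem M W) (i : B) (w : W) :
    leftDown cs i w = w ∨ leftDown cs i w = cs.simple i * w := by
  unfold leftDown
  split_ifs <;> simp

theorem simple_mul_bruhatLE_simple_mul {t : W} (ht : cs.IsReflection t) {i : B}
    (hti : t ≠ cs.simple i) (h : cs.length u < cs.length (t * u)) :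
    bruhatLE cs (cs.simple i * u) (cs.simple i * (t * u)) :=
  .single ⟨⟨cs.simple i * t * (cs.simple i)⁻¹, ht.conj _, by simp [mul_assoc]⟩,
    ht.length_simple_mul_lt hti h⟩

/-- The lifting property: `w ↦ max(w, sᵢ w)` and `w ↦ min(w, sᵢ w)` are monotone for the
Bruhat order. -/
theorem bruhatLE.leftUp_and_leftDown (h : bruhatLE cs u v) (i : B) :
    bruhatLE cs (leftUp cs i u) (leftUp cs i v) ∧
      bruhatLE cs (leftDown cs i u) (leftDown cs i v) := by
  induction h with
  | refl => exact ⟨.refl, .refl⟩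
  | @tail a b _ hab ih =>
    refine ⟨ih.1.trans ?_, ih.2.trans ?_⟩ <;> clear ih <;>
      obtain ⟨⟨t, ht, rfl⟩, hlt⟩ := hab <;> by_cases hti : t = cs.simple i
    · subst hti
      rw [leftUp, leftUp, if_pos hlt, cs.simple_mul_simple_cancel_left, if_neg hlt.not_gt]
    · have hs := simple_mul_bruhatLE_simple_mul ht hti hlt
      rcases leftUp_eq_or cs i a with h | h <;> rw [h]
      · exact (bruhatLE_mul_of_length_lt ht hlt).trans (bruhatLE_leftUp cs i _).1
      · exact hs.trans (bruhatLE_leftUp cs i _).2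
    · subst hti
      rw [leftDown, leftDown, if_pos hlt, cs.simple_mul_simple_cancel_left, if_neg hlt.not_gt]
    · have hs := simple_mul_bruhatLE_simple_mul ht hti hlt
      rcases leftDown_eq_or cs i (t * a) with h | h <;> rw [h]
      · exact (leftDown_bruhatLE cs i _).1.trans (bruhatLE_mul_of_length_lt ht hlt)
      · exact (leftDown_bruhatLE cs i _).2.trans hs

/-- The largest element reached from `w` by going up along left, then right, multiplication
by `sᵢ`. -/
noncomputable def twoSidedUp (cs : CoxeterSystem M W) (i : B) (w : W) : W :=
  (leftUp cs i (leftUp cs i w)⁻¹)⁻¹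

/-- The smallest element reached from `w` by going down along left, then right, multiplication
by `sᵢ`. -/
noncomputable def twoSidedDown (cs : CoxeterSystem M W) (i : B) (w : W) : W :=
  (leftDown cs i (leftDown cs i w)⁻¹)⁻¹

theorem bruhatLE.twoSidedUp (h : bruhatLE cs u v) (i : B) :
    bruhatLE cs (twoSidedUp cs i u) (twoSidedUp cs i v) :=
  ((h.leftUp_and_leftDown i).1.inv.leftUp_and_leftDown i).1.inv

theorem bruhatLE.twoSidedDown (h : bruhatLE cs u v) (i : B) :
    bruhatLE cs (twoSidedDown cs i u) (twoSidedDown cs i v) :=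
  ((h.leftUp_and_leftDown i).2.inv.leftUp_and_leftDown i).2.inv

theorem length_simple_mul_inv (cs : CoxeterSystem M W) (i : B) (w : W) :
    cs.length (cs.simple i * w⁻¹) = cs.length (w * cs.simple i) := by
  rw [← cs.length_inv]
  simp

theorem length_lt_simple_mul_of_lt_conjOp {σ : W} {i : B}
    (h : cs.length σ < cs.length (conjOp cs i σ)) :
    cs.length σ < cs.length (cs.simple i * σ) := by
  unfold conjOp at h
  split_ifs at h
  · exact h
  · have h1 := cs.length_simple_mul σ i
    have h2 := cs.length_mul_simple (cs.simple i * σ) i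
    omega

theorem length_simple_mul_lt_of_conjOp_lt {σ : W} {i : B}
    (h : cs.length (conjOp cs i σ) < cs.length σ) :
    cs.length (cs.simple i * σ) < cs.length σ := by
  unfold conjOp at h
  split_ifs at h
  · exact h
  · have h1 := cs.length_simple_mul σ i
    have h2 := cs.length_mul_simple (cs.simple i * σ) i
    omega

theorem twoSidedUp_eq_conjOp {σ : W} {i : B}
    (h : cs.length σ < cs.length (conjOp cs i σ)) : twoSidedUp cs i σ = conjOp cs i σ := by
  have hl := length_lt_simple_mul_of_lt_conjOp h
  have h1 := cs.length_simple_mul σ i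
  have h2 := cs.length_mul_simple (cs.simple i * σ) i
  unfold twoSidedUp
  rw [leftUp, leftUp, if_pos hl, length_simple_mul_inv, cs.length_inv]
  by_cases hc : cs.simple i * σ = σ * cs.simple i
  · have h3 : cs.simple i * σ * cs.simple i = σ := by
      rw [hc, cs.simple_mul_simple_cancel_right]
    rw [h3, if_neg hl.not_gt, conjOp, if_pos hc, inv_inv]
  · rw [conjOp, if_neg hc] at h ⊢
    rw [if_pos (by omega)]
    simp

theorem twoSidedDown_eq_conjOp {σ : W} {i : B}
    (h : cs.length (conjOp cs i σ) < cs.length σ) : twoSidedDown cs i σ = conjOp cs i σ := by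
  have hl := length_simple_mul_lt_of_conjOp_lt h
  have h1 := cs.length_simple_mul σ i
  have h2 := cs.length_mul_simple (cs.simple i * σ) i
  unfold twoSidedDown
  rw [leftDown, leftDown, if_neg hl.not_gt, length_simple_mul_inv, cs.length_inv]
  by_cases hc : cs.simple i * σ = σ * cs.simple i
  · have h3 : cs.simple i * σ * cs.simple i = σ := by
      rw [hc, cs.simple_mul_simple_cancel_right]
    rw [h3, if_pos hl, conjOp, if_pos hc, inv_inv]
  · rw [conjOp, if_neg hc] at h ⊢
    rw [if_neg (by omega)]
    simp

theorem twoSidedUp_eq_self {σ : W} (hσ : σ * σ = 1) {i : B}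
    (h : cs.length (cs.simple i * σ) < cs.length σ) : twoSidedUp cs i σ = σ := by
  simp [twoSidedUp, leftUp, h.not_gt, inv_eq_of_mul_eq_one_left hσ]

theorem twoSidedDown_eq_self {σ : W} (hσ : σ * σ = 1) {i : B}
    (h : cs.length σ < cs.length (cs.simple i * σ)) : twoSidedDown cs i σ = σ := by
  simp [twoSidedDown, leftDown, h, inv_eq_of_mul_eq_one_left hσ]

end Bruhat

/-- Let `σ < τ` be involutions in a Coxeter group and `s` a simple reflection.
If `s∘σ > σ` and `s∘τ < τ`, then `s∘σ ≤ τ` and `σ ≤ s∘τ`. -/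
theorem stmt_12 (cs : CoxeterSystem M W) (σ τ : W)
    (hσ : σ * σ = 1) (hτ : τ * τ = 1) (hστ : bruhatLT cs σ τ) (i : B)
    (h1 : bruhatLT cs σ (conjOp cs i σ)) (h2 : bruhatLT cs (conjOp cs i τ) τ) :
    bruhatLE cs (conjOp cs i σ) τ ∧ bruhatLE cs σ (conjOp cs i τ) := by
  have hle : bruhatLE cs σ τ := hστ.to_reflTransGen
  have hup := hle.twoSidedUp i
  have hdown := hle.twoSidedDown i
  rw [twoSidedUp_eq_conjOp h1.length_lt,
    twoSidedUp_eq_self hτ (length_simple_mul_lt_of_conjOp_lt h2.length_lt)] at hup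
  rw [twoSidedDown_eq_conjOp h2.length_lt,
    twoSidedDown_eq_self hσ (length_lt_simple_mul_of_lt_conjOp h1.length_lt)] at hdown
  exact ⟨hup, hdown⟩
end
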